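/- arXiv:2501.09163 — 4 statements merged into one kernel-verified Lean document; each statement's English description precedes it below -/
import Mathlib

section
/- Let d_s and d_x be positive integers, let L > 0 and D ≥ 0 be real numbers, and let f₁, f₂ : ℝ^{d_s} → ℝ^{d_x} be L-Lipschitz maps. Let S ⊆ ℝ^{d_s} be a nonempty set such that ‖f₁ a − f₂ b‖ ≥ D for all a, b ∈ S. If s₁, s₂ ∈ ℝ^{d_s} satisfy f₁ s₁ = f₂ s₂, then max (infDist s₁ S) (infDist s₂ S) ≥ D / (2 * L). -/
/-- **Deterministic core of Theorem 1 (extrapolation under dense shifts).**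
A data point lying on two `D`-separated class manifolds, each an `L`-Lipschitz
image of the changing-variable space, must have off-support distance at least
`D / (2L)` in at least one of its two latent representations. -/
theorem dense_shift_max_infDist
    {d_s d_x : ℕ} (hd_s : 0 < d_s) (hd_x : 0 < d_x)
    {L D : ℝ} (hL : 0 < L) (hD : 0 ≤ D)
    (f₁ f₂ : EuclideanSpace ℝ (Fin d_s) → EuclideanSpace ℝ (Fin d_x))
    (hf₁ : ∀ a b, dist (f₁ a) (f₁ b) ≤ L * dist a b)
    (hf₂ : ∀ a b, dist (f₂ a) (f₂ b) ≤ L * dist a b)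
    (S : Set (EuclideanSpace ℝ (Fin d_s))) (hS : S.Nonempty)
    (hsep : ∀ a ∈ S, ∀ b ∈ S, ‖f₁ a - f₂ b‖ ≥ D)
    (s₁ s₂ : EuclideanSpace ℝ (Fin d_s)) (heq : f₁ s₁ = f₂ s₂) :
    max (Metric.infDist s₁ S) (Metric.infDist s₂ S) ≥ D / (2 * L) := by
  by_contra hlt
  rw [ge_iff_le, not_le, max_lt_iff] at hlt
  obtain ⟨h1, h2⟩ := hlt
  obtain ⟨a, ha, hda⟩ := (Metric.infDist_lt_iff hS).1 h1
  obtain ⟨b, hb, hdb⟩ := (Metric.infDist_lt_iff hS).1 h2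
  have h3 := hsep a ha b hb
  rw [← dist_eq_norm] at h3
  have h4 := dist_triangle (f₁ a) (f₁ s₁) (f₂ b)
  have h5 := hf₁ s₁ a
  have h6 := hf₂ s₂ b
  rw [dist_comm (f₁ a) (f₁ s₁), heq] at h4
  rw [heq] at h5
  rw [lt_div_iff₀ (by positivity)] at hda hdb
  linarith
end

section
/- Let d_s and d_x be positive integers, let L > 0 and D ≥ 0 be real numbers, and let f₁, f₂ : ℝ^{d_s} → ℝ^{d_x} be L-Lipschitz maps. Let S ⊆ ℝ^{d_s} be a nonempty set such that ‖f₁ a − f₂ b‖ ≥ D for all a, b ∈ S. Suppose s₁, s₂ ∈ ℝ^{d_s} satisfy f₁ s₁ = f₂ s₂ and infDist s₁ S < D / (2 * L). Then infDist s₂ S > D / (2 * L), and in particular infDist s₂ S > infDist s₁ S. -/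
/-- **Identification step in the proof of Theorem 1 (dense shifts).**
Under the out-of-support distance assumption `infDist s₁ S < D / (2L)`, any
alternative class manifold explaining the target sample requires a strictly
larger off-support distance: `infDist s₂ S > D / (2L) > infDist s₁ S`. -/
theorem dense_shift_identification
    {d_s d_x : ℕ} (hd_s : 0 < d_s) (hd_x : 0 < d_x)
    {L D : ℝ} (hL : 0 < L) (hD : 0 ≤ D)
    (f₁ f₂ : EuclideanSpace ℝ (Fin d_s) → EuclideanSpace ℝ (Fin d_x))
    (hf₁ : ∀ a b, dist (f₁ a) (f₁ b) ≤ L * dist a b)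
    (hf₂ : ∀ a b, dist (f₂ a) (f₂ b) ≤ L * dist a b)
    (S : Set (EuclideanSpace ℝ (Fin d_s))) (hS : S.Nonempty)
    (hsep : ∀ a ∈ S, ∀ b ∈ S, ‖f₁ a - f₂ b‖ ≥ D)
    (s₁ s₂ : EuclideanSpace ℝ (Fin d_s)) (heq : f₁ s₁ = f₂ s₂)
    (hclose : Metric.infDist s₁ S < D / (2 * L)) :
    Metric.infDist s₂ S > D / (2 * L) ∧ Metric.infDist s₂ S > Metric.infDist s₁ S := by
  obtain ⟨a, ha, hda⟩ := (Metric.infDist_lt_iff hS).1 hclose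
  have key : D / L - dist s₁ a ≤ Metric.infDist s₂ S := by
    rw [Metric.le_infDist hS]
    intro b hb
    have h1 := hsep a ha b hb
    rw [← dist_eq_norm] at h1
    have h2 := dist_triangle (f₁ a) (f₁ s₁) (f₂ b)
    have h3 := hf₁ a s₁
    have h4 := hf₂ s₂ b
    rw [dist_comm a s₁] at h3
    rw [← heq] at h4
    have h5 : D / L ≤ dist s₁ a + dist s₂ b := by
      rw [div_le_iff₀ hL]
      linarith
    linarith
  have h6 : D / L = D / (2 * L) + D / (2 * L) := by
    field_simp
    ring
  have h7 : D / (2 * L) < Metric.infDist s₂ S := by linarith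
  exact ⟨h7, hclose.trans h7⟩
end

section
/- Let n and m be positive integers and let g, ĝ : ℝ^n → ℝ^m be differentiable maps. Assume there exist differentiable maps g⁻ : ℝ^m → ℝ^n and ĝ⁻ : ℝ^m → ℝ^n with g⁻ ∘ g = id and ĝ⁻ ∘ ĝ = id, and assume Set.range g = Set.range ĝ. Fix z ∈ ℝ^n and set ẑ := ĝ⁻ (g z). Then for every subset 𝒮 of the output coordinates Fin m, the rank of the submatrix of the Jacobian matrix of g at z consisting of the rows indexed by 𝒮 equals the rank of the submatrix of the Jacobian matrix of ĝ at ẑ consisting of the rows indexed by 𝒮. -/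
/-- The Jacobian matrix of a map `f : ℝ^n → ℝ^m` at a point `z`: its `(i, j)`
entry is the `i`-th component of the Fréchet derivative applied to the `j`-th
standard basis vector. -/
noncomputable def jacobianMatrix {n m : ℕ}
    (f : EuclideanSpace ℝ (Fin n) → EuclideanSpace ℝ (Fin m))
    (z : EuclideanSpace ℝ (Fin n)) : Matrix (Fin m) (Fin n) ℝ :=
  fun i j => fderiv ℝ f z (EuclideanSpace.single j 1) i

/-- The submatrix of `M` consisting of the rows with index in `P`. -/
def rowSubmatrix {R : Type*} {p q : ℕ} (M : Matrix (Fin p) (Fin q) R)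
    (P : Finset (Fin p)) : Matrix {i // i ∈ P} (Fin q) R :=
  M.submatrix (fun i => (i : Fin p)) id

/-- Chain rule: the Jacobian of a composition is the product of the Jacobians. -/
theorem jacobianMatrix_comp_aux {n m : ℕ}
    (h : EuclideanSpace ℝ (Fin n) → EuclideanSpace ℝ (Fin m))
    (v : EuclideanSpace ℝ (Fin n) → EuclideanSpace ℝ (Fin n))
    (hh : Differentiable ℝ h) (hv : Differentiable ℝ v) (z : EuclideanSpace ℝ (Fin n)) :
    jacobianMatrix (h ∘ v) z = jacobianMatrix h (v z) * jacobianMatrix v z := by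
  ext i j
  simp only [jacobianMatrix, Matrix.mul_apply]
  rw [fderiv_comp z (hh (v z)) (hv z), ContinuousLinearMap.comp_apply]
  set w := fderiv ℝ v z (EuclideanSpace.single j 1)
  have hw : w = ∑ k, w k • EuclideanSpace.single k (1 : ℝ) := by
    ext l
    simp [Pi.single_apply]
  conv_lhs => rw [hw]
  simp [map_sum, mul_comm]

theorem rank_rowSubmatrix_comp_le_aux {n m : ℕ}
    (h : EuclideanSpace ℝ (Fin n) → EuclideanSpace ℝ (Fin m))
    (v : EuclideanSpace ℝ (Fin n) → EuclideanSpace ℝ (Fin n))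
    (hh : Differentiable ℝ h) (hv : Differentiable ℝ v) (z : EuclideanSpace ℝ (Fin n))
    (P : Finset (Fin m)) :
    (rowSubmatrix (jacobianMatrix (h ∘ v) z) P).rank
      ≤ (rowSubmatrix (jacobianMatrix h (v z)) P).rank := by
  have e : rowSubmatrix (jacobianMatrix (h ∘ v) z) P
      = rowSubmatrix (jacobianMatrix h (v z)) P * jacobianMatrix v z := by
    rw [jacobianMatrix_comp_aux h v hh hv z]
    rfl
  rw [e]
  exact Matrix.rank_mul_le_left _ _

/-- **Lemma A2 (from Brady et al.): Jacobian row-submatrix ranks are invariant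
under differentiable invertible reparametrization.** If `g` and `gEst` are
differentiable, have differentiable left inverses, and share the same range,
then for every set `𝒮` of output coordinates, the rank of the rows of the
Jacobian of `g` at `z` indexed by `𝒮` equals the rank of the corresponding rows
of the Jacobian of `gEst` at `zEst = gEstInv (g z)`. -/
theorem jacobian_submatrix_rank_invariance
    {n m : ℕ} (hn : 0 < n) (hm : 0 < m)
    (g gEst : EuclideanSpace ℝ (Fin n) → EuclideanSpace ℝ (Fin m))
    (hg : Differentiable ℝ g) (hgEst : Differentiable ℝ gEst)
    (gInv gEstInv : EuclideanSpace ℝ (Fin m) → EuclideanSpace ℝ (Fin n))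
    (hgInv : Differentiable ℝ gInv) (hgEstInv : Differentiable ℝ gEstInv)
    (hgl : gInv ∘ g = id) (hgEstl : gEstInv ∘ gEst = id)
    (hrange : Set.range g = Set.range gEst)
    (z : EuclideanSpace ℝ (Fin n)) :
    ∀ 𝒮 : Finset (Fin m),
      (rowSubmatrix (jacobianMatrix g z) 𝒮).rank
        = (rowSubmatrix (jacobianMatrix gEst (gEstInv (g z))) 𝒮).rank := by
  intro P
  have h1 : gEst ∘ (gEstInv ∘ g) = g := by
    funext x
    obtain ⟨y, hy⟩ : g x ∈ Set.range gEst := hrange ▸ Set.mem_range_self x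
    have := congrFun hgEstl y
    simp only [Function.comp_apply, id] at this ⊢
    rw [← hy, this]
  have h2 : g ∘ (gInv ∘ gEst) = gEst := by
    funext x
    obtain ⟨y, hy⟩ : gEst x ∈ Set.range g := hrange ▸ Set.mem_range_self x
    have := congrFun hgl y
    simp only [Function.comp_apply, id] at this ⊢
    rw [← hy, this]
  have h3 : (gInv ∘ gEst) (gEstInv (g z)) = z := by
    have a := congrFun h1 z
    have b := congrFun hgl z
    simp only [Function.comp_apply, id] at a b ⊢
    rw [a, b]
  have l1 := rank_rowSubmatrix_comp_le_aux gEst (gEstInv ∘ g) hgEst (hgEstInv.comp hg) z P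
  have l2 := rank_rowSubmatrix_comp_le_aux g (gInv ∘ gEst) hg (hgInv.comp hgEst)
    (gEstInv (g z)) P
  rw [h1] at l1
  rw [h2, h3] at l2
  exact le_antisymm l1 l2
end

section
/- Let F be a field and let M be a matrix over F with rows indexed by Fin p and columns indexed by Fin q. Let C ⊆ Fin q be a set of columns and let P₁, P₂ ⊆ Fin p be disjoint sets of rows. Assume M i j = 0 for all i ∈ P₁ and j ∈ C, and that the submatrix M[P₂, C] (rows in P₂, columns in C) has rank equal to the cardinality of P₂, i.e., its rows are linearly independent. Then the rank of the row-submatrix M[P₁ ∪ P₂] equals the rank of M[P₁] plus the cardinality of P₂. -/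
/-- The submatrix of `M` keeping rows in `P` and columns in `C`. -/
def subMatrix {R : Type*} {p q : ℕ} (M : Matrix (Fin p) (Fin q) R)
    (P : Finset (Fin p)) (C : Finset (Fin q)) : Matrix {i // i ∈ P} {j // j ∈ C} R :=
  M.submatrix (fun i => (i : Fin p)) (fun j => (j : Fin q))

/-- **Rank additivity (sparse-shift proof of Theorem 2).** If the rows in `P₁`
vanish on the columns in `C` and the rows in `P₂` restricted to the columns in
`C` are linearly independent (`rank M[P₂, C] = |P₂|`), then
`rank M[P₁ ∪ P₂] = rank M[P₁] + |P₂|`. -/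
theorem rank_union_of_vanishing_and_full_row_rank
    {F : Type*} [Field F] {p q : ℕ}
    (M : Matrix (Fin p) (Fin q) F)
    (C : Finset (Fin q)) (P₁ P₂ : Finset (Fin p)) (hdisj : Disjoint P₁ P₂)
    (hzero : ∀ i ∈ P₁, ∀ j ∈ C, M i j = 0)
    (hfull : (subMatrix M P₂ C).rank = P₂.card) :
    (rowSubmatrix M (P₁ ∪ P₂)).rank = (rowSubmatrix M P₁).rank + P₂.card := by
  classical
  let f : (Fin q → F) →ₗ[F] ({j // j ∈ C} → F) := LinearMap.funLeft F F (fun j => (j : Fin q))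
  let v : {i // i ∈ P₂} → (Fin q → F) := fun i => M.row i
  have hli : LinearIndependent F (f ∘ v) := by
    rw [linearIndependent_iff_card_eq_finrank_span]
    rw [Matrix.rank_eq_finrank_span_row] at hfull
    rw [Fintype.card_coe, ← hfull]
    rfl
  have hv : LinearIndependent F v := LinearIndependent.of_comp f hli
  have hd : Disjoint (Submodule.span F (Set.range v)) (LinearMap.ker f) :=
    Submodule.range_ker_disjoint hli
  have hrow : ∀ P : Finset (Fin p), Set.range (rowSubmatrix M P).row = M.row '' (P : Set (Fin p)) := by
    intro P
    ext x
    constructor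
    · rintro ⟨i, rfl⟩
      exact ⟨i, i.2, rfl⟩
    · rintro ⟨i, hi, rfl⟩
      exact ⟨⟨i, hi⟩, rfl⟩
  have hle : Submodule.span F (M.row '' (P₁ : Set (Fin p))) ≤ LinearMap.ker f := by
    rw [Submodule.span_le]
    rintro _ ⟨i, hi, rfl⟩
    rw [SetLike.mem_coe, LinearMap.mem_ker]
    ext j
    exact hzero i hi j j.2
  have hrv : Set.range v = M.row '' (P₂ : Set (Fin p)) := hrow P₂
  have hcard := finrank_span_eq_card hv
  rw [Fintype.card_coe] at hcard
  have hinf := (hd.mono_right hle).symm.eq_bot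
  have h := Submodule.finrank_sup_add_finrank_inf_eq
    (Submodule.span F (M.row '' (P₁ : Set (Fin p)))) (Submodule.span F (Set.range v))
  rw [hinf, finrank_bot, add_zero, hcard, hrv, ← Submodule.span_union, ← Set.image_union] at h
  rw [Matrix.rank_eq_finrank_span_row, Matrix.rank_eq_finrank_span_row, hrow, hrow,
    Finset.coe_union]
  exact h
end
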